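/- Let V be a finite-dimensional real vector space with a nondegenerate symmetric bilinear form γ₀, and let J₊, J₋ be real endomorphisms of V with J₊² = J₋² = -Id, J₊∘J₋ + J₋∘J₊ = 0, and γ₀(J_± X, Y) + γ₀(X, J_± Y) = 0 for both signs. Then for any real numbers α, β with β² - α² = 1, the complex endomorphism F = α J₊ + i β J₋ of V^ℂ satisfies F² = Id and γ₀^ℂ(F X, Y) + γ₀^ℂ(X, F Y) = 0; hence (γ₀, ψ, F) is the triple of a generalized almost para-Hermitian structure on V for any antisymmetric bilinear form ψ on V. -/

import Mathlib

noncomputable section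

open TensorProduct

attribute [local instance 3000] TensorProduct.addCommMonoid TensorProduct.leftModule

/-- The "big tangent space" `V ⊕ V*`. -/
abbrev Big (V : Type) [AddCommGroup V] [Module ℝ V] : Type := V × Module.Dual ℝ V

variable (V : Type) [AddCommGroup V] [Module ℝ V]

/-- The pairing metric `g((X,α),(Y,β)) = (α Y + β X)/2` on `V ⊕ V*`. -/
def gP : Big V →ₗ[ℝ] Big V →ₗ[ℝ] ℝ :=
  LinearMap.mk₂ ℝ (fun u v => (u.2 v.1 + v.2 u.1) / 2)
    (fun m₁ m₂ n => by simp; ring)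
    (fun c m n => by simp; ring)
    (fun m n₁ n₂ => by simp; ring)
    (fun c m n => by simp; ring)

/-- A generalized almost para-complex structure on `V`. -/
def IsGenParaCx (F : Big V →ₗ[ℝ] Big V) : Prop :=
  F ∘ₗ F = LinearMap.id ∧ ∀ u v, gP V (F u) v = - gP V u (F v)

/-- A generalized almost complex structure on `V`. -/
def IsGenCx (J : Big V →ₗ[ℝ] Big V) : Prop :=
  J ∘ₗ J = - LinearMap.id ∧ ∀ u v, gP V (J u) v = - gP V u (J v)

/-- The bilinear form `γ(α,β) = -2 g(𝓕(0,α), 𝓙(0,β))` on `V*`. -/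
def gammaOf (F J : Big V →ₗ[ℝ] Big V) (α β : Module.Dual ℝ V) : ℝ :=
  -2 * gP V (F (0, α)) (J (0, β))

/-- A generalized almost para-Hermitian structure on `V`: a commuting pair of a
generalized almost para-complex structure and a generalized almost complex structure
whose associated bilinear form `γ` on `V*` is nondegenerate. -/
def IsGAPH (F J : Big V →ₗ[ℝ] Big V) : Prop :=
  IsGenParaCx V F ∧ IsGenCx V J ∧ F ∘ₗ J = J ∘ₗ F ∧
    ∀ α, (∀ β, gammaOf V F J α β = 0) → α = 0

/-- Complexification of `V`. -/
abbrev Vc : Type := ℂ ⊗[ℝ] V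

/-- Complexification of the big space `V ⊕ V*`. -/
abbrev Bc : Type := ℂ ⊗[ℝ] Big V

/-- The projection `(V ⊕ V*)^ℂ → V^ℂ`. -/
def prV : Bc V →ₗ[ℂ] Vc V := LinearMap.baseChange ℂ (LinearMap.fst ℝ V (Module.Dual ℝ V))

/-- The inclusion `V^ℂ → (V ⊕ V*)^ℂ`, `X ↦ (X, 0)`. -/
def inV : Vc V →ₗ[ℂ] Bc V := LinearMap.baseChange ℂ (LinearMap.inl ℝ V (Module.Dual ℝ V))

/-- The complexified pairing metric on `(V ⊕ V*)^ℂ`. -/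
def gc : Bc V →ₗ[ℂ] Bc V →ₗ[ℂ] ℂ := LinearMap.BilinForm.baseChange ℂ (gP V)

/-- Complex-bilinear extension of a bilinear form on `V` to `V^ℂ`. -/
def bcB (B : LinearMap.BilinForm ℝ V) : Vc V →ₗ[ℂ] Vc V →ₗ[ℂ] ℂ :=
  LinearMap.BilinForm.baseChange ℂ B

/-- The `μ`-eigenspace of an endomorphism of `(V ⊕ V*)^ℂ`. -/
def eigSp (T : Bc V →ₗ[ℂ] Bc V) (μ : ℂ) : Submodule ℂ (Bc V) where
  carrier := {u | T u = μ • u}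
  add_mem' := by
    intro a b ha hb
    simp only [Set.mem_setOf_eq, map_add] at *
    rw [ha, hb, smul_add]
  zero_mem' := by simp
  smul_mem' := by
    intro c u hu
    simp only [Set.mem_setOf_eq, map_smul] at *
    rw [hu, smul_comm]

/-- The `i`-eigenspace of the complexification of an endomorphism of `V ⊕ V*`. -/
def Hsp (H : Big V →ₗ[ℝ] Big V) : Submodule ℂ (Bc V) :=
  eigSp V (LinearMap.baseChange ℂ H) Complex.I

/-- The `+1`-eigenspace of the complexification of an endomorphism of `V ⊕ V*`. -/
def Fplus (F : Big V →ₗ[ℝ] Big V) : Submodule ℂ (Bc V) :=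
  eigSp V (LinearMap.baseChange ℂ F) 1

/-- The `-1`-eigenspace of the complexification of an endomorphism of `V ⊕ V*`. -/
def Fminus (F : Big V →ₗ[ℝ] Big V) : Submodule ℂ (Bc V) :=
  eigSp V (LinearMap.baseChange ℂ F) (-1)

/-- The graph `{(X, ψ^ℂ(X,·) + i γ₀^ℂ(X,·)) : X ∈ V^ℂ}` inside `(V ⊕ V*)^ℂ`.
An element `u = (X, α)` lies on the graph iff `α(Y) = ψ^ℂ(X,Y) + i γ₀^ℂ(X,Y)` for all
`Y ∈ V^ℂ`; the value `α(Y)` is expressed canonically as `2 g^ℂ(u, (Y,0))`. -/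
def graphSet (γ₀ ψ : LinearMap.BilinForm ℝ V) : Set (Bc V) :=
  {u | ∀ Y : Vc V, 2 * gc V u (inV V Y) =
      bcB V ψ (prV V u) Y + Complex.I * bcB V γ₀ (prV V u) Y}

/-- Complex conjugation of `(V ⊕ V*)^ℂ` with respect to the real form `V ⊕ V*`. -/
def conjMap : Bc V →ₗ[ℝ] Bc V := LinearMap.rTensor (Big V) Complex.conjAe.toLinearMap

/-- The complex conjugate of a complex subspace of `(V ⊕ V*)^ℂ` (the image of the
subspace under conjugation; taking the `ℂ`-span does not enlarge the image, since the
image of a complex subspace under conjugation is again a complex subspace). -/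
def conjSub (S : Submodule ℂ (Bc V)) : Submodule ℂ (Bc V) :=
  Submodule.span ℂ (conjMap V '' (S : Set (Bc V)))

noncomputable instance (S : Submodule ℂ (Bc V)) : AddCommGroup ↥S :=
  Module.addCommMonoidToAddCommGroup ℂ

/-- A `g`-isotropic subspace of `(V ⊕ V*)^ℂ`. -/
def IsIsotropic (S : Submodule ℂ (Bc V)) : Prop := ∀ u ∈ S, ∀ v ∈ S, gc V u v = 0

/-- A maximal `g`-isotropic subspace of `(V ⊕ V*)^ℂ`: a `g`-isotropic subspace of
complex dimension `dim V`. -/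
def MaxIsotropic (S : Submodule ℂ (Bc V)) : Prop :=
  IsIsotropic V S ∧ Module.finrank ℂ S = Module.finrank ℝ V

/-- The endomorphism of `V^ℂ` induced by an endomorphism `A` of `V ⊕ V*` via `τ`:
`X ↦ pr_{V^ℂ} (A^ℂ (τ X))`. -/
def Fop (A : Big V →ₗ[ℝ] Big V) (τ : Vc V →ₗ[ℂ] Bc V) : Vc V → Vc V :=
  fun X => prV V (LinearMap.baseChange ℂ A (τ X))

/-- The canonical (real) inclusion `V → V^ℂ`. -/
def realIncl : V →ₗ[ℝ] Vc V := TensorProduct.mk ℝ ℂ V 1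

/-- The canonical (real) inclusion `V ⊕ V* → (V ⊕ V*)^ℂ`. -/
def realInclB : Big V →ₗ[ℝ] Bc V := TensorProduct.mk ℝ ℂ (Big V) 1

/-- The B-field transformation `(X, α) ↦ (X, α + B(X,·))` of `V ⊕ V*`. -/
def Bfield (B : LinearMap.BilinForm ℝ V) : Big V →ₗ[ℝ] Big V :=
  LinearMap.prod (LinearMap.fst ℝ V (Module.Dual ℝ V))
    (LinearMap.snd ℝ V (Module.Dual ℝ V) + B ∘ₗ LinearMap.fst ℝ V (Module.Dual ℝ V))

/-- `(X, α) ↦ (F X, -α ∘ F)`. -/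
def genF (F : V →ₗ[ℝ] V) : Big V →ₗ[ℝ] Big V := F.prodMap (- F.dualMap)

/-- `(X, α) ↦ (♯ α, -γ₀(X,·))`. -/
def genH (γ₀ : LinearMap.BilinForm ℝ V) (sharp : Module.Dual ℝ V →ₗ[ℝ] V) :
    Big V →ₗ[ℝ] Big V :=
  LinearMap.prod (sharp ∘ₗ LinearMap.snd ℝ V (Module.Dual ℝ V))
    (- (γ₀ ∘ₗ LinearMap.fst ℝ V (Module.Dual ℝ V)))

/-- The projection `(1/4)(Id + 𝓕^ℂ) ∘ (Id - i 𝓗^ℂ)` onto `𝐇₊`, as a function. -/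
def prHplus (F H : Big V →ₗ[ℝ] Big V) (u : Bc V) : Bc V :=
  ((1 : ℂ)/4) • ((u - Complex.I • LinearMap.baseChange ℂ H u) +
    LinearMap.baseChange ℂ F (u - Complex.I • LinearMap.baseChange ℂ H u))

/-- The projection `(1/4)(Id - 𝓕^ℂ) ∘ (Id - i 𝓗^ℂ)` onto `𝐇₋`, as a function. -/
def prHminus (F H : Big V →ₗ[ℝ] Big V) (u : Bc V) : Bc V :=
  ((1 : ℂ)/4) • ((u - Complex.I • LinearMap.baseChange ℂ H u) -
    LinearMap.baseChange ℂ F (u - Complex.I • LinearMap.baseChange ℂ H u))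

/-- The inclusion `W ⊕ V* → V ⊕ V*` over a subspace `W ⊆ V`. -/
def bigIncl (W : Submodule ℝ V) : (↥W × Module.Dual ℝ V) →ₗ[ℝ] Big V :=
  (W.subtype).prodMap LinearMap.id

/-- The restriction `W ⊕ V* → W ⊕ W*`, restricting functionals to `W`. -/
def bigRes (W : Submodule ℝ V) : (↥W × Module.Dual ℝ V) →ₗ[ℝ] Big ↥W :=
  LinearMap.prodMap LinearMap.id (W.subtype.dualMap)

/-- The pullback `ι*U = {(X, η∘ι) : X ∈ W^ℂ, (X, η) ∈ U}` of a subspace of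
`(V ⊕ V*)^ℂ` to `(W ⊕ W*)^ℂ`. -/
def pullback (W : Submodule ℝ V) (U : Submodule ℂ (Bc V)) : Submodule ℂ (Bc ↥W) :=
  Submodule.map (LinearMap.baseChange ℂ (bigRes V W))
    (Submodule.comap (LinearMap.baseChange ℂ (bigIncl V W)) U)

/-- Restriction of a bilinear form on `V` to a subspace `W`. -/
def resB (W : Submodule ℝ V) (B : LinearMap.BilinForm ℝ V) : LinearMap.BilinForm ℝ ↥W :=
  B.compl₁₂ W.subtype W.subtype

section Frame

variable {V}

lemma exists_eq_one_tmul_add_I_tmul {M : Type} [AddCommGroup M] [Module ℝ M] (x : ℂ ⊗[ℝ] M) :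
    ∃ v w : M, x = (1 : ℂ) ⊗ₜ[ℝ] v + Complex.I ⊗ₜ[ℝ] w := by
  induction x using TensorProduct.induction_on with
  | zero => exact ⟨0, 0, by simp⟩
  | tmul z v =>
    refine ⟨z.re • v, z.im • v, ?_⟩
    rw [← TensorProduct.smul_tmul, ← TensorProduct.smul_tmul, ← TensorProduct.add_tmul]
    congr 1
    apply Complex.ext <;> simp
  | add x y hx hy =>
    obtain ⟨v, w, rfl⟩ := hx
    obtain ⟨v', w', rfl⟩ := hy
    refine ⟨v + v', w + w', ?_⟩
    rw [TensorProduct.tmul_add, TensorProduct.tmul_add]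
    exact add_add_add_comm _ _ _ _

lemma one_tmul_add_I_tmul_inj {M : Type} [AddCommGroup M] [Module ℝ M] {v w v' w' : M} :
    (1 : ℂ) ⊗ₜ[ℝ] v + Complex.I ⊗ₜ[ℝ] w = (1 : ℂ) ⊗ₜ[ℝ] v' + Complex.I ⊗ₜ[ℝ] w' ↔
      v = v' ∧ w = w' := by
  refine ⟨fun h => ⟨?_, ?_⟩, by rintro ⟨rfl, rfl⟩; rfl⟩
  · simpa using congrArg (TensorProduct.lid ℝ M ∘ LinearMap.rTensor M Complex.reLm) h
  · simpa using congrArg (TensorProduct.lid ℝ M ∘ LinearMap.rTensor M Complex.imLm) h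

lemma I_smul_one_tmul_add_I_tmul {M : Type} [AddCommGroup M] [Module ℝ M] (v w : M) :
    Complex.I • ((1 : ℂ) ⊗ₜ[ℝ] v + Complex.I ⊗ₜ[ℝ] w) =
      (1 : ℂ) ⊗ₜ[ℝ] (-w) + Complex.I ⊗ₜ[ℝ] v := by
  rw [smul_add, TensorProduct.smul_tmul', TensorProduct.smul_tmul', smul_eq_mul, smul_eq_mul,
    Complex.I_mul_I, mul_one, TensorProduct.tmul_neg, TensorProduct.neg_tmul, add_comm]

lemma bcB_tmul (B : LinearMap.BilinForm ℝ V) (z w : ℂ) (x y : V) :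
    bcB V B (z ⊗ₜ[ℝ] x) (w ⊗ₜ[ℝ] y) = w * z * (B x y : ℂ) := by
  simp [bcB, LinearMap.BilinForm.baseChange_tmul, mul_comm]

lemma bcB_skew {B : LinearMap.BilinForm ℝ V} {P : V →ₗ[ℝ] V}
    (hP : ∀ X Y, B (P X) Y + B X (P Y) = 0) (x y : Vc V) :
    bcB V B (LinearMap.baseChange ℂ P x) y + bcB V B x (LinearMap.baseChange ℂ P y) = 0 := by
  induction x using TensorProduct.induction_on with
  | zero => simp
  | add x x' hx hx' =>
    simp only [map_add, LinearMap.add_apply]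
    linear_combination hx + hx'
  | tmul z v =>
    induction y using TensorProduct.induction_on with
    | zero => simp
    | add y y' hy hy' =>
      simp only [map_add]
      linear_combination hy + hy'
    | tmul w v' =>
      simp only [LinearMap.baseChange_tmul, bcB_tmul]
      have h : ((B (P v) v' : ℝ) : ℂ) + (B v (P v') : ℝ) = 0 := by exact_mod_cast hP v v'
      linear_combination w * z * h

/-- The identification `(X, Y) ↦ (X, ψ(X,·) + γ(Y,·))` of `V ⊕ V` with `V ⊕ V*`, for a linear
equivalence `γ : V ≃ V*`. -/
def frame (γ : V ≃ₗ[ℝ] Module.Dual ℝ V) (ψ : LinearMap.BilinForm ℝ V) : (V × V) ≃ₗ[ℝ] Big V :=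
  (LinearEquiv.refl ℝ V).skewProd γ ψ

lemma frame_apply (γ : V ≃ₗ[ℝ] Module.Dual ℝ V) (ψ : LinearMap.BilinForm ℝ V) (p : V × V) :
    frame γ ψ p = (p.1, γ p.2 + ψ p.1) := rfl

lemma gP_frame {γ : V ≃ₗ[ℝ] Module.Dual ℝ V} {ψ : LinearMap.BilinForm ℝ V}
    (hψ : ∀ x y, ψ x y = - ψ y x) (p q : V × V) :
    gP V (frame γ ψ p) (frame γ ψ q) = (γ p.2 q.1 + γ q.2 p.1) / 2 := by
  simp only [gP, frame_apply, LinearMap.mk₂_apply, LinearMap.add_apply]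
  rw [hψ p.1 q.1]
  ring

/-- In the frame, the real endomorphism of `V ⊕ V*` inducing `P + i Q` on the graph of
`ψ + i γ`. -/
def frameF (γ : V ≃ₗ[ℝ] Module.Dual ℝ V) (ψ : LinearMap.BilinForm ℝ V) (P Q : V →ₗ[ℝ] V) :
    Big V →ₗ[ℝ] Big V :=
  (frame γ ψ).conj ((P.coprod Q).prod ((-Q).coprod P))

/-- In the frame, the composition of `(X, Y) ↦ (Y, -X)` with `frameF`. -/
def frameJ (γ : V ≃ₗ[ℝ] Module.Dual ℝ V) (ψ : LinearMap.BilinForm ℝ V) (P Q : V →ₗ[ℝ] V) :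
    Big V →ₗ[ℝ] Big V :=
  (frame γ ψ).conj (((-Q).coprod P).prod ((-P).coprod (-Q)))

variable {γ : V ≃ₗ[ℝ] Module.Dual ℝ V} {ψ : LinearMap.BilinForm ℝ V} {P Q : V →ₗ[ℝ] V}

lemma frameF_frame (p : V × V) :
    frameF γ ψ P Q (frame γ ψ p) = frame γ ψ (P p.1 + Q p.2, -Q p.1 + P p.2) := by
  simp [frameF, LinearEquiv.conj_apply]

lemma frameJ_frame (p : V × V) :
    frameJ γ ψ P Q (frame γ ψ p) = frame γ ψ (-Q p.1 + P p.2, -P p.1 - Q p.2) := by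
  simp [frameJ, LinearEquiv.conj_apply, sub_eq_add_neg]

lemma frameJ_frameF_frame (hsq : ∀ x, P (P x) - Q (Q x) = x) (hac : ∀ x, P (Q x) + Q (P x) = 0)
    (p : V × V) :
    frameJ γ ψ P Q (frameF γ ψ P Q (frame γ ψ p)) = frame γ ψ (p.2, -p.1) := by
  rw [frameF_frame, frameJ_frame]
  congr 1
  ext
  · simp only [map_add, map_neg]
    linear_combination (norm := module) hsq p.2 - hac p.1
  · simp only [map_add, map_neg]
    linear_combination (norm := module) - hsq p.1 - hac p.2

lemma isGAPH_frame (hγ : ∀ x y, γ x y = γ y x) (hψ : ∀ x y, ψ x y = - ψ y x)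
    (hsq : ∀ x, P (P x) - Q (Q x) = x) (hac : ∀ x, P (Q x) + Q (P x) = 0)
    (hP : ∀ X Y, γ (P X) Y + γ X (P Y) = 0) (hQ : ∀ X Y, γ (Q X) Y + γ X (Q Y) = 0) :
    IsGAPH V (frameF γ ψ P Q) (frameJ γ ψ P Q) := by
  refine ⟨⟨?_, ?_⟩, ⟨?_, ?_⟩, ?_, ?_⟩
  · refine LinearMap.ext fun u => ?_
    obtain ⟨p, rfl⟩ := (frame γ ψ).surjective u
    simp only [LinearMap.comp_apply, LinearMap.id_apply, frameF_frame]
    congr 1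
    ext
    · simp only [map_add, map_neg]
      linear_combination (norm := module) hsq p.1 + hac p.2
    · simp only [map_add, map_neg]
      linear_combination (norm := module) hsq p.2 - hac p.1
  · intro u v
    obtain ⟨p, rfl⟩ := (frame γ ψ).surjective u
    obtain ⟨q, rfl⟩ := (frame γ ψ).surjective v
    simp only [frameF_frame, gP_frame hψ, map_add, map_neg, LinearMap.add_apply,
      LinearMap.neg_apply]
    linarith [hP p.2 q.1, hP q.2 p.1, hQ p.1 q.1, hQ q.2 p.2, hγ (Q q.1) p.1, hγ p.1 (Q q.1),
      hγ (Q q.2) p.2]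
  · refine LinearMap.ext fun u => ?_
    obtain ⟨p, rfl⟩ := (frame γ ψ).surjective u
    simp only [LinearMap.comp_apply, LinearMap.neg_apply, LinearMap.id_apply, frameJ_frame,
      ← map_neg (frame γ ψ)]
    congr 1
    ext
    · simp only [map_add, map_neg, map_sub, Prod.fst_neg]
      linear_combination (norm := module) - hsq p.1 - hac p.2
    · simp only [map_add, map_neg, map_sub, Prod.snd_neg]
      linear_combination (norm := module) - hsq p.2 + hac p.1
  · intro u v
    obtain ⟨p, rfl⟩ := (frame γ ψ).surjective u
    obtain ⟨q, rfl⟩ := (frame γ ψ).surjective v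
    simp only [frameJ_frame, gP_frame hψ, map_add, map_neg, map_sub, LinearMap.neg_apply,
      LinearMap.sub_apply]
    linarith [hP p.1 q.1, hP q.2 p.2, hQ p.2 q.1, hQ q.2 p.1, hγ (P q.1) p.1, hγ (P q.2) p.2]
  · refine LinearMap.ext fun u => ?_
    obtain ⟨p, rfl⟩ := (frame γ ψ).surjective u
    simp only [LinearMap.comp_apply, frameJ_frame, frameF_frame]
    congr 1
    ext
    · simp only [map_add, map_neg, map_sub]
      module
    · simp only [map_add, map_neg, map_sub]
      module
  · intro α hα
    obtain ⟨y, rfl⟩ := γ.surjective α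
    have hframe : ∀ z, ((0, γ z) : Big V) = frame γ ψ (0, z) := fun z => by simp [frame_apply]
    have key : ∀ z, γ y z = 0 := fun z => by
      have h := hα (γ z)
      simp only [gammaOf, hframe, frameF_frame, frameJ_frame, gP_frame hψ, map_zero, neg_zero,
        zero_add, zero_sub, map_neg, LinearMap.neg_apply] at h
      have h' := congrArg (fun w => γ w z) (hsq y)
      simp only [map_sub, LinearMap.sub_apply] at h'
      linarith [hP (P y) z, hQ (Q y) z, hγ (Q z) (Q y)]
    exact LinearMap.ext key

lemma exists_eq_frame (γ : V ≃ₗ[ℝ] Module.Dual ℝ V) (ψ : LinearMap.BilinForm ℝ V) (u : Bc V) :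
    ∃ p q : V × V, u = (1 : ℂ) ⊗ₜ[ℝ] frame γ ψ p + Complex.I ⊗ₜ[ℝ] frame γ ψ q := by
  obtain ⟨v, w, rfl⟩ := exists_eq_one_tmul_add_I_tmul u
  obtain ⟨p, rfl⟩ := (frame γ ψ).surjective v
  obtain ⟨q, rfl⟩ := (frame γ ψ).surjective w
  exact ⟨p, q, rfl⟩

lemma mem_Hsp_frame (hsq : ∀ x, P (P x) - Q (Q x) = x) (hac : ∀ x, P (Q x) + Q (P x) = 0)
    (p q : V × V) :
    (1 : ℂ) ⊗ₜ[ℝ] frame γ ψ p + Complex.I ⊗ₜ[ℝ] frame γ ψ q ∈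
      Hsp V (frameJ γ ψ P Q ∘ₗ frameF γ ψ P Q) ↔ p.2 = -q.1 ∧ q.2 = p.1 := by
  change LinearMap.baseChange ℂ _ _ = _ ↔ _
  rw [I_smul_one_tmul_add_I_tmul, map_add, LinearMap.baseChange_tmul, LinearMap.baseChange_tmul,
    LinearMap.comp_apply, LinearMap.comp_apply, frameJ_frameF_frame hsq hac,
    frameJ_frameF_frame hsq hac, ← map_neg (frame γ ψ), one_tmul_add_I_tmul_inj,
    (frame γ ψ).injective.eq_iff, (frame γ ψ).injective.eq_iff]
  simp only [Prod.ext_iff, Prod.fst_neg, Prod.snd_neg]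
  grind

lemma mem_graphSet_frame (p q : V × V) :
    (1 : ℂ) ⊗ₜ[ℝ] frame γ ψ p + Complex.I ⊗ₜ[ℝ] frame γ ψ q ∈
      graphSet V (γ : LinearMap.BilinForm ℝ V) ψ ↔ p.2 = -q.1 ∧ q.2 = p.1 := by
  have hgc : ∀ (z w : ℂ) (u v : Big V),
      gc V (z ⊗ₜ[ℝ] u) (w ⊗ₜ[ℝ] v) = w * z * (gP V u v : ℂ) := fun z w u v => by
    simp [gc, LinearMap.BilinForm.baseChange_tmul, mul_comm]
  have hgP : ∀ (p : V × V) (y : V), gP V (frame γ ψ p) (y, 0) = (γ p.2 y + ψ p.1 y) / 2 :=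
    fun p y => by simp [gP, frame_apply]
  have hdiff : ∀ (w : ℂ) (y : V),
      2 * gc V ((1 : ℂ) ⊗ₜ[ℝ] frame γ ψ p + Complex.I ⊗ₜ[ℝ] frame γ ψ q) (inV V (w ⊗ₜ[ℝ] y)) -
        (bcB V ψ (prV V ((1 : ℂ) ⊗ₜ[ℝ] frame γ ψ p + Complex.I ⊗ₜ[ℝ] frame γ ψ q)) (w ⊗ₜ[ℝ] y) +
          Complex.I * bcB V (γ : LinearMap.BilinForm ℝ V)
            (prV V ((1 : ℂ) ⊗ₜ[ℝ] frame γ ψ p + Complex.I ⊗ₜ[ℝ] frame γ ψ q)) (w ⊗ₜ[ℝ] y)) =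
      w * ((γ (p.2 + q.1) y : ℝ) + Complex.I * (γ (q.2 - p.1) y : ℝ)) := fun w y => by
    simp only [inV, prV, map_add, map_sub, LinearMap.add_apply, LinearMap.sub_apply,
      LinearMap.baseChange_tmul, LinearMap.inl_apply, LinearMap.fst_apply, hgc, hgP, bcB_tmul,
      LinearEquiv.coe_coe]
    simp only [frame_apply]
    push_cast
    linear_combination (- w * (γ q.1 y : ℂ)) * Complex.I_mul_I
  constructor
  · intro h
    have hzero : ∀ y, ((γ (p.2 + q.1) y : ℝ) : ℂ) + Complex.I * (γ (q.2 - p.1) y : ℝ) = 0 :=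
      fun y => by simpa only [one_mul] using (hdiff 1 y).symm.trans (sub_eq_zero.2 (h _))
    have h₁ : γ (p.2 + q.1) = 0 :=
      LinearMap.ext fun y => by simpa using congrArg Complex.re (hzero y)
    have h₂ : γ (q.2 - p.1) = 0 :=
      LinearMap.ext fun y => by simpa using congrArg Complex.im (hzero y)
    rw [LinearEquiv.map_eq_zero_iff] at h₁ h₂
    exact ⟨eq_neg_of_add_eq_zero_left h₁, sub_eq_zero.1 h₂⟩
  · rintro ⟨h₁, h₂⟩ Y
    induction Y using TensorProduct.induction_on with
    | zero => simp
    | tmul w y =>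
      rw [← sub_eq_zero, hdiff, h₁, h₂]
      simp
    | add Y Z hY hZ =>
      simp only [map_add (inV V), map_add (gc V _), map_add (bcB V _ _)]
      linear_combination hY + hZ

lemma prV_frameF {u : Bc V} (hsq : ∀ x, P (P x) - Q (Q x) = x)
    (hac : ∀ x, P (Q x) + Q (P x) = 0)
    (hu : u ∈ Hsp V (frameJ γ ψ P Q ∘ₗ frameF γ ψ P Q)) :
    prV V (LinearMap.baseChange ℂ (frameF γ ψ P Q) u) =
      LinearMap.baseChange ℂ P (prV V u) + Complex.I • LinearMap.baseChange ℂ Q (prV V u) := by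
  obtain ⟨p, q, rfl⟩ := exists_eq_frame γ ψ u
  obtain ⟨h₁, h₂⟩ := (mem_Hsp_frame hsq hac p q).1 hu
  simp only [prV, map_add, LinearMap.baseChange_tmul, frameF_frame, LinearMap.fst_apply]
  simp only [I_smul_one_tmul_add_I_tmul]
  simp only [frame_apply, h₁, h₂, map_neg]
  rw [add_add_add_comm, ← TensorProduct.tmul_add, ← TensorProduct.tmul_add]

end Frame

/-- If `Jp, Jm` are anticommuting `γ₀`-skew almost complex structures
on `V` and `α, β ∈ ℝ` with `β² - α² = 1`, then `F = α Jp + i β Jm ∈ End(V^ℂ)` satisfies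
`F² = Id` and `γ₀^ℂ(FX,Y) + γ₀^ℂ(X,FY) = 0`; hence for every antisymmetric `ψ`, the
triple `(γ₀, ψ, F)` is the triple of a generalized almost para-Hermitian structure. -/
theorem anticommuting_pair_structure (V : Type) [AddCommGroup V] [Module ℝ V]
    [FiniteDimensional ℝ V]
    (γ₀ : LinearMap.BilinForm ℝ V)
    (hsym : ∀ x y, γ₀ x y = γ₀ y x) (hnd : ∀ x, (∀ y, γ₀ x y = 0) → x = 0)
    (Jp Jm : V →ₗ[ℝ] V)
    (hJp : Jp ∘ₗ Jp = - LinearMap.id) (hJm : Jm ∘ₗ Jm = - LinearMap.id)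
    (hac : Jp ∘ₗ Jm + Jm ∘ₗ Jp = 0)
    (hskp : ∀ X Y, γ₀ (Jp X) Y + γ₀ X (Jp Y) = 0)
    (hskm : ∀ X Y, γ₀ (Jm X) Y + γ₀ X (Jm Y) = 0)
    (a b : ℝ) (hab : b ^ 2 - a ^ 2 = 1) :
    ∀ F : Vc V →ₗ[ℂ] Vc V,
      F = (a : ℂ) • LinearMap.baseChange ℂ Jp + (Complex.I * (b : ℂ)) • LinearMap.baseChange ℂ Jm →
      (F ∘ₗ F = LinearMap.id) ∧
      (∀ X Y, bcB V γ₀ (F X) Y + bcB V γ₀ X (F Y) = 0) ∧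
      (∀ ψ : LinearMap.BilinForm ℝ V, (∀ x y, ψ x y = - ψ y x) →
        ∃ 𝓕 𝓙 : Big V →ₗ[ℝ] Big V, IsGAPH V 𝓕 𝓙 ∧
          ((Hsp V (𝓙 ∘ₗ 𝓕) : Set (Bc V)) = graphSet V γ₀ ψ) ∧
          (∀ u ∈ Hsp V (𝓙 ∘ₗ 𝓕),
            prV V (LinearMap.baseChange ℂ 𝓕 u) = F (prV V u))) := by
  rintro F rfl
  have hsq : ∀ x, (a • Jp) ((a • Jp) x) - (b • Jm) ((b • Jm) x) = x := fun x => by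
    have hp : Jp (Jp x) = -x := LinearMap.congr_fun hJp x
    have hm : Jm (Jm x) = -x := LinearMap.congr_fun hJm x
    simp only [LinearMap.smul_apply, map_smul, hp, hm]
    linear_combination (norm := module) hab • x
  have hanti : ∀ x, (a • Jp) ((b • Jm) x) + (b • Jm) ((a • Jp) x) = 0 := fun x => by
    have h : Jp (Jm x) + Jm (Jp x) = 0 := LinearMap.congr_fun hac x
    simp only [LinearMap.smul_apply, map_smul]
    linear_combination (norm := module) (a * b) • h
  refine ⟨?_, ?_, ?_⟩
  · refine LinearMap.ext fun x => ?_
    induction x using TensorProduct.induction_on with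
    | zero => simp
    | add x y hx hy => rw [map_add, hx, hy, map_add]
    | tmul z v =>
      have hp : Jp (Jp v) = -v := LinearMap.congr_fun hJp v
      have hm : Jm (Jm v) = -v := LinearMap.congr_fun hJm v
      have h : Jm (Jp v) = -Jp (Jm v) :=
        eq_neg_of_add_eq_zero_right (LinearMap.congr_fun hac v)
      simp only [LinearMap.comp_apply, LinearMap.add_apply, LinearMap.smul_apply, map_add,
        map_smul, LinearMap.baseChange_tmul, hp, hm, h, TensorProduct.tmul_neg,
        LinearMap.id_apply]
      have hab' : (b : ℂ) ^ 2 - (a : ℂ) ^ 2 = 1 := by exact_mod_cast hab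
      have hI := Complex.I_mul_I
      linear_combination (norm := module)
        (hab' - (b : ℂ) ^ 2 * hI) • (z ⊗ₜ[ℝ] v)
  · intro X Y
    simp only [LinearMap.add_apply, LinearMap.smul_apply, map_add, map_smul, smul_eq_mul]
    linear_combination (a : ℂ) * bcB_skew hskp X Y + Complex.I * b * bcB_skew hskm X Y
  · intro ψ hψ
    have hinj : Function.Injective γ₀ := (injective_iff_map_eq_zero γ₀).2 fun x hx =>
      hnd x fun y => LinearMap.congr_fun hx y
    obtain ⟨γ, rfl⟩ : ∃ γ : V ≃ₗ[ℝ] Module.Dual ℝ V, γ.toLinearMap = γ₀ :=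
      ⟨LinearEquiv.ofInjectiveOfFinrankEq γ₀ hinj Subspace.dual_finrank_eq.symm, rfl⟩
    have hskew : ∀ (c : ℝ) (J : V →ₗ[ℝ] V), (∀ X Y, γ (J X) Y + γ X (J Y) = 0) →
        ∀ X Y, γ ((c • J) X) Y + γ X ((c • J) Y) = 0 := fun c J hJ X Y => by
      simp only [LinearMap.smul_apply, map_smul, smul_eq_mul]
      linear_combination c * hJ X Y
    refine ⟨frameF γ ψ (a • Jp) (b • Jm), frameJ γ ψ (a • Jp) (b • Jm),
      isGAPH_frame hsym hψ hsq hanti (hskew a Jp hskp) (hskew b Jm hskm), ?_, fun u hu => ?_⟩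
    · ext u
      obtain ⟨p, q, rfl⟩ := exists_eq_frame γ ψ u
      exact (mem_Hsp_frame hsq hanti p q).trans (mem_graphSet_frame p q).symm
    · rw [prV_frameF hsq hanti hu]
      have hsmul : ∀ (c : ℝ) (J : V →ₗ[ℝ] V) (x : Vc V),
          LinearMap.baseChange ℂ (c • J) x = (c : ℂ) • LinearMap.baseChange ℂ J x := fun c J x => by
        rw [LinearMap.baseChange_smul, LinearMap.smul_apply]
        rfl
      rw [hsmul, hsmul, smul_smul, LinearMap.add_apply, LinearMap.smul_apply,
        LinearMap.smul_apply]
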